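/- arXiv:2207.06756 — 3 statements merged into one kernel-verified Lean document; each statement's English description precedes it below -/
import Mathlib

section
/- For every continuous function f : [0,∞) → ℝ vanishing at infinity, lim_{n→∞} ‖𝒫ₙf − f‖_∞ = 0, i.e. the Szász–Mirakyan approximations converge to f uniformly on [0,∞). -/
open Filter

/-- The Szász–Mirakyan operator `𝒫ₙ`. -/
noncomputable def szasz (n : ℕ) (f : ℝ → ℝ) (x : ℝ) : ℝ :=
  ∑' k : ℕ, Real.exp (-((n : ℝ) * x)) * ((n : ℝ) * x) ^ k / (Nat.factorial k) *
    f ((k : ℝ) / (n : ℝ))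

/-- Multiplying the Poisson weights by `k` shifts the index and multiplies by the rate. -/
theorem HasSum.poisson_weight_mul_natCast {r a : ℝ} {g : ℕ → ℝ}
    (h : HasSum (fun k : ℕ => Real.exp (-r) * r ^ k / (Nat.factorial k) * g (k + 1)) a) :
    HasSum (fun k : ℕ => Real.exp (-r) * r ^ k / (Nat.factorial k) * (k * g k)) (r * a) := by
  rw [← hasSum_nat_add_iff' 1]
  simp only [Finset.sum_range_one, Nat.cast_zero, zero_mul, mul_zero, sub_zero]
  refine (h.mul_left r).congr_fun fun k => ?_
  have hk : (Nat.factorial k : ℝ) ≠ 0 := by positivity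
  rw [Nat.factorial_succ]
  push_cast
  field_simp
  ring

theorem hasSum_poisson_weight (r : ℝ) :
    HasSum (fun k : ℕ => Real.exp (-r) * r ^ k / (Nat.factorial k)) 1 := by
  have h := (NormedSpace.expSeries_div_hasSum_exp r).mul_left (Real.exp (-r))
  rw [← Real.exp_eq_exp_ℝ, ← Real.exp_add, neg_add_cancel, Real.exp_zero] at h
  simpa only [mul_div_assoc] using h

/-- The second moment of a Poisson variable of rate `n * x`, scaled by `1 / n`, about `x`. -/
theorem hasSum_poisson_weight_mul_sq {n : ℕ} (hn : n ≠ 0) (x : ℝ) :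
    HasSum (fun k : ℕ => Real.exp (-((n : ℝ) * x)) * ((n : ℝ) * x) ^ k / (Nat.factorial k) *
      ((k : ℝ) / n - x) ^ 2) (x / n) := by
  have h0 := hasSum_poisson_weight (n * x)
  have h1 := HasSum.poisson_weight_mul_natCast (g := fun _ => 1) (by simpa using h0)
  have h2 := HasSum.poisson_weight_mul_natCast (r := n * x) (g := fun k => (k : ℝ))
    (a := n * x * 1 + 1) (by simpa [mul_add] using h1.add h0)
  have hn' : (n : ℝ) ≠ 0 := Nat.cast_ne_zero.mpr hn
  have h3 := ((h2.mul_right (1 / (n : ℝ) ^ 2)).add (h1.mul_right (-2 * x / n))).add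
    (h0.mul_right (x ^ 2))
  rw [show n * x * (n * x * 1 + 1) * (1 / (n : ℝ) ^ 2) + n * x * 1 * (-2 * x / n) + 1 * x ^ 2 =
    x / n by field_simp; ring] at h3
  exact h3.congr_fun fun k => by ring

/-- A continuous function on `[0,∞)` vanishing at infinity is bounded, and its oscillation is
controlled by a weighted square of the distance. -/
theorem exists_abs_sub_le_add_sq_div {f : ℝ → ℝ} (hfc : ContinuousOn f (Set.Ici 0))
    (hf0 : Tendsto f atTop (nhds 0)) {ε : ℝ} (hε : 0 < ε) :
    ∃ C ≥ (0 : ℝ), ∀ x ≥ (0 : ℝ), ∀ y ≥ (0 : ℝ),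
      |f y - f x| ≤ ε + C / (1 + x) * (y - x) ^ 2 := by
  have hgc : Continuous fun x : ℝ => f |x| := hfc.comp_continuous continuous_abs abs_nonneg
  have hg0 : Tendsto (fun x : ℝ => f |x|) (cocompact ℝ) (nhds 0) :=
    hf0.comp (tendsto_norm_cocompact_atTop (E := ℝ))
  obtain ⟨δ, hδ, hfδ⟩ := Metric.uniformContinuous_iff.mp
    (hgc.uniformContinuous_of_tendsto_cocompact hg0) ε hε
  obtain ⟨M, hM⟩ : ∃ M, ∀ x ≥ (0 : ℝ), |f x| ≤ M := by
    let G : ZeroAtInftyContinuousMap ℝ ℝ := ⟨⟨_, hgc⟩, hg0⟩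
    refine ⟨‖G.toBCF‖, fun x hx => ?_⟩
    have h := G.toBCF.norm_coe_le_norm x
    change |f (|x|)| ≤ _ at h
    rwa [abs_of_nonneg hx] at h
  obtain ⟨R₀, hR₀⟩ := eventually_atTop.mp
    (Metric.tendsto_nhds.mp hf0 (ε / 2) (half_pos hε))
  set R := max R₀ 1
  have hR : ∀ y ≥ R, |f y| < ε / 2 := fun y hy => by
    simpa using hR₀ y ((le_max_left _ _).trans hy)
  have hR1 : 1 ≤ R := le_max_right _ _
  have hM0 : 0 ≤ M := (abs_nonneg _).trans (hM 0 le_rfl)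
  refine ⟨2 * M * (1 + 2 * R) / δ ^ 2 + 8 * M, by positivity, fun x hx y hy => ?_⟩
  have hbd : |f y - f x| ≤ 2 * M := by
    linarith [abs_sub (f y) (f x), hM x hx, hM y hy]
  have hx1 : 0 < 1 + x := by linarith
  have hA : 0 ≤ 2 * M * (1 + 2 * R) / δ ^ 2 := by positivity
  have hsq := sq_nonneg (y - x)
  rw [div_mul_eq_mul_div]
  by_cases hxR : x ≤ 2 * R
  · by_cases hd : |y - x| < δ
    · have h := hfδ (a := y) (b := x) (by simpa [Real.dist_eq] using hd)
      simp only [Real.dist_eq, abs_of_nonneg hx, abs_of_nonneg hy] at h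
      have : 0 ≤ (2 * M * (1 + 2 * R) / δ ^ 2 + 8 * M) * (y - x) ^ 2 / (1 + x) := by positivity
      linarith
    · have hd2 : δ ^ 2 ≤ (y - x) ^ 2 := by
        rw [← sq_abs (y - x)]
        gcongr
        exact not_lt.mp hd
      have : 2 * M ≤ (2 * M * (1 + 2 * R) / δ ^ 2 + 8 * M) * (y - x) ^ 2 / (1 + x) := by
        rw [le_div_iff₀ hx1]
        calc 2 * M * (1 + x) ≤ 2 * M * (1 + 2 * R) := by gcongr
          _ = 2 * M * (1 + 2 * R) / δ ^ 2 * δ ^ 2 := by field_simp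
          _ ≤ (2 * M * (1 + 2 * R) / δ ^ 2 + 8 * M) * (y - x) ^ 2 := by
            gcongr
            linarith
      linarith
  · push Not at hxR
    by_cases hyR : R ≤ y
    · have : 0 ≤ (2 * M * (1 + 2 * R) / δ ^ 2 + 8 * M) * (y - x) ^ 2 / (1 + x) := by positivity
      linarith [abs_sub (f y) (f x), hR y hyR, hR x (by linarith)]
    · have hd2 : (1 + x) / 4 ≤ (y - x) ^ 2 := by nlinarith
      have : 2 * M ≤ (2 * M * (1 + 2 * R) / δ ^ 2 + 8 * M) * (y - x) ^ 2 / (1 + x) := by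
        rw [le_div_iff₀ hx1]
        calc 2 * M * (1 + x) = 8 * M * ((1 + x) / 4) := by ring
          _ ≤ (2 * M * (1 + 2 * R) / δ ^ 2 + 8 * M) * (y - x) ^ 2 := by
            gcongr
            linarith
      linarith

/-- A quadratic bound on the oscillation of `f` around `x` bounds the error of `szasz n f x`. -/
theorem abs_szasz_sub_le {f : ℝ → ℝ} {n : ℕ} (hn : n ≠ 0) {x ε C : ℝ} (hx : 0 ≤ x)
    (h : ∀ y ≥ (0 : ℝ), |f y - f x| ≤ ε + C * (y - x) ^ 2) :
    |szasz n f x - f x| ≤ ε + C * (x / n) := by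
  have h0 := hasSum_poisson_weight (n * x)
  have hB := (h0.mul_right ε).add ((hasSum_poisson_weight_mul_sq hn x).mul_left C)
  rw [one_mul] at hB
  have hle : ∀ k : ℕ, ‖Real.exp (-((n : ℝ) * x)) * ((n : ℝ) * x) ^ k / (Nat.factorial k) *
      (f ((k : ℝ) / n) - f x)‖ ≤
      Real.exp (-((n : ℝ) * x)) * ((n : ℝ) * x) ^ k / (Nat.factorial k) * ε +
      C * (Real.exp (-((n : ℝ) * x)) * ((n : ℝ) * x) ^ k / (Nat.factorial k) *
        ((k : ℝ) / n - x) ^ 2) := fun k => by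
    have hp : 0 ≤ Real.exp (-((n : ℝ) * x)) * ((n : ℝ) * x) ^ k / (Nat.factorial k) := by
      positivity
    rw [norm_mul, Real.norm_of_nonneg hp, Real.norm_eq_abs]
    linarith [mul_le_mul_of_nonneg_left (h ((k : ℝ) / n) (by positivity)) hp]
  have hD := (Summable.of_norm_bounded hB.summable hle).hasSum
  have hS := hD.add (h0.mul_right (f x))
  simp only [← mul_add, sub_add_cancel, one_mul] at hS
  rw [szasz, hS.tsum_eq, add_sub_cancel_right]
  exact tsum_of_norm_bounded hB hle

/-- **Szász's theorem.**  For every continuous `f : [0,∞) → ℝ` vanishing at infinity,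
`lim_{n → ∞} ‖𝒫ₙ f − f‖_∞ = 0`, i.e. `𝒫ₙ f → f` uniformly on `[0,∞)`. -/
theorem szasz_uniform_convergence (f : ℝ → ℝ) (hfc : ContinuousOn f (Set.Ici 0))
    (hf0 : Tendsto f atTop (nhds 0)) :
    ∀ ε > (0 : ℝ), ∃ N : ℕ, ∀ n ≥ N, ∀ x ≥ (0 : ℝ), |szasz n f x - f x| < ε := by
  intro ε hε
  obtain ⟨C, hC, h⟩ := exists_abs_sub_le_add_sq_div hfc hf0 (half_pos hε)
  obtain ⟨N, hN⟩ := exists_nat_gt (C / (ε / 2))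
  refine ⟨N, fun n hn x hx => ?_⟩
  have hCn : C / (ε / 2) < n := hN.trans_le (Nat.cast_le.mpr hn)
  have hn0 : (0 : ℝ) < n := lt_of_le_of_lt (by positivity) hCn
  refine (abs_szasz_sub_le (Nat.cast_pos.mp hn0).ne' hx (h x hx)).trans_lt ?_
  have hx1 : x / (1 + x) ≤ 1 := div_le_one_of_le₀ (by linarith) (by linarith)
  calc ε / 2 + C / (1 + x) * (x / n) = ε / 2 + C / n * (x / (1 + x)) := by ring
    _ ≤ ε / 2 + C / n := by
      gcongr
      exact mul_le_of_le_one_right (by positivity) hx1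
    _ < ε := by
      have : C / n < ε / 2 := (div_lt_comm₀ (half_pos hε) hn0).mp hCn
      linarith
end

section
/- Let α ≥ 1. For every f ∈ C_∞^{w_α}([0,∞)), lim_{n→∞} ‖𝒫ₙf − f‖_{∞,w_α} = 0. -/
open Filter

/-- The weight function `w_α(x) = 1 / (1 + x^α)`. -/
noncomputable def wt (α : ℝ) (x : ℝ) : ℝ := 1 / (1 + x ^ α)

theorem HasSum.of_forall_eq {u v : ℕ → ℝ} {a b : ℝ} (h : HasSum u a) (huv : ∀ k, v k = u k)
    (hab : b = a) : HasSum v b := by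
  rw [hab, funext huv]
  exact h

/-- The weight that the Poisson distribution of mean `r` gives to `k`. -/
noncomputable def poissonWeight (r : ℝ) (k : ℕ) : ℝ :=
  Real.exp (-r) * r ^ k / (Nat.factorial k)

theorem poissonWeight_nonneg {r : ℝ} (hr : 0 ≤ r) (k : ℕ) : 0 ≤ poissonWeight r k := by
  unfold poissonWeight
  positivity

theorem hasSum_poissonWeight_mul_pow (r q : ℝ) :
    HasSum (fun k => poissonWeight r k * q ^ k) (Real.exp (r * (q - 1))) := by
  have h := (NormedSpace.expSeries_div_hasSum_exp (r * q)).mul_left (Real.exp (-r))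
  rw [← Real.exp_eq_exp_ℝ, ← Real.exp_add] at h
  refine h.of_forall_eq (fun k => ?_) ?_
  · unfold poissonWeight
    rw [mul_pow]
    ring
  · congr 1
    ring

theorem hasSum_poissonWeight (r : ℝ) : HasSum (poissonWeight r) 1 := by
  simpa using hasSum_poissonWeight_mul_pow r 1

theorem poissonWeight_succ (r : ℝ) (k : ℕ) :
    poissonWeight r (k + 1) * ((k : ℝ) + 1) = r * poissonWeight r k := by
  unfold poissonWeight
  rw [Nat.factorial_succ]
  push_cast
  field_simp
  ring

theorem hasSum_poissonWeight_mul_self (r : ℝ) :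
    HasSum (fun k => poissonWeight r k * k) r := by
  rw [← hasSum_nat_add_iff' 1]
  simpa [poissonWeight_succ] using (hasSum_poissonWeight r).mul_left r

theorem hasSum_poissonWeight_mul_sq (r : ℝ) :
    HasSum (fun k => poissonWeight r k * (k : ℝ) ^ 2) (r ^ 2 + r) := by
  rw [← hasSum_nat_add_iff' 1]
  refine (((hasSum_poissonWeight_mul_self r).add (hasSum_poissonWeight r)).mul_left r).of_forall_eq
    (fun k => ?_) ?_
  · push_cast
    linear_combination ((k : ℝ) + 1) * poissonWeight_succ r k
  · simp
    ring

theorem hasSum_poissonWeight_mul_sub_sq {n : ℕ} (hn : 0 < n) (x : ℝ) :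
    HasSum (fun k : ℕ => poissonWeight (n * x) k * ((k : ℝ) / n - x) ^ 2) (x / n) := by
  have hn' : (n : ℝ) ≠ 0 := by positivity
  refine ((((hasSum_poissonWeight_mul_sq (n * x)).mul_left (1 / (n : ℝ) ^ 2)).sub
    ((hasSum_poissonWeight_mul_self (n * x)).mul_left (2 * x / n))).add
    ((hasSum_poissonWeight (n * x)).mul_left (x ^ 2))).of_forall_eq (fun k => ?_) ?_
  · field_simp
    ring
  · field_simp
    ring

theorem exists_hasSum_poissonWeight_mul_exp {n : ℕ} (hn : 0 < n) {x : ℝ} (hx : 0 ≤ x) :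
    ∃ s ≤ Real.exp 2,
      HasSum (fun k : ℕ => poissonWeight (n * x) k * Real.exp ((k : ℝ) / n / (1 + x))) s := by
  have hn' : (1 : ℝ) ≤ n := by exact_mod_cast hn
  have hu : 0 ≤ 1 / (n * (1 + x)) := by positivity
  refine ⟨_, Real.exp_le_exp.2 ?_, (hasSum_poissonWeight_mul_pow (n * x)
    (Real.exp (1 / (n * (1 + x))))).of_forall_eq (fun k => ?_) rfl⟩
  rotate_left
  · rw [← Real.exp_nat_mul]
    congr 2
    field_simp
  · have hu1 : |1 / (n * (1 + x))| ≤ 1 := by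
      rw [abs_of_nonneg hu, div_le_one (by positivity)]
      nlinarith
    have h := (abs_le.1 (Real.abs_exp_sub_one_le hu1)).2
    rw [abs_of_nonneg hu] at h
    calc n * x * (Real.exp (1 / (n * (1 + x))) - 1) ≤ n * x * (2 * (1 / (n * (1 + x)))) := by
          gcongr
      _ = 2 * (x / (1 + x)) := by field_simp
      _ ≤ 2 := by
          have : x / (1 + x) ≤ 1 := (div_le_one (by positivity)).2 (by linarith)
          linarith

theorem abs_szasz_sub_le_s6 {n : ℕ} {f g : ℝ → ℝ} {x s : ℝ} (hx : 0 ≤ x)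
    (hg : HasSum (fun k : ℕ => poissonWeight (n * x) k * g ((k : ℝ) / n)) s)
    (hfg : ∀ y, 0 ≤ y → |f y - f x| ≤ g y) : |szasz n f x - f x| ≤ s := by
  have hb : ∀ k : ℕ, ‖poissonWeight (n * x) k * (f ((k : ℝ) / n) - f x)‖ ≤
      poissonWeight (n * x) k * g ((k : ℝ) / n) := fun k => by
    have hp := poissonWeight_nonneg (r := n * x) (by positivity) k
    rw [Real.norm_eq_abs, abs_mul, abs_of_nonneg hp]
    exact mul_le_mul_of_nonneg_left (hfg _ (by positivity)) hp
  have hs := (Summable.of_norm_bounded hg.summable hb).hasSum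
  have hs' := hs.add ((hasSum_poissonWeight (n * x)).mul_right (f x))
  have he : szasz n f x = (∑' k : ℕ, poissonWeight (n * x) k * (f ((k : ℝ) / n) - f x))
      + 1 * f x := by
    rw [← hs'.tsum_eq]
    refine tsum_congr fun k => ?_
    change poissonWeight (n * x) k * f ((k : ℝ) / n) = _
    ring
  rw [he, one_mul, add_sub_cancel_right]
  exact tsum_of_norm_bounded hg hb

theorem exists_rpow_le_mul_exp {α : ℝ} (hα : 0 ≤ α) :
    ∃ C : ℝ, 0 ≤ C ∧ ∀ z, 0 ≤ z → z ^ α ≤ C * Real.exp z := by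
  refine ⟨1 + (Nat.factorial ⌈α⌉₊), by positivity, fun z hz => ?_⟩
  have h1 : (1 : ℝ) ≤ Real.exp z := Real.one_le_exp hz
  have h2 : z ^ ⌈α⌉₊ ≤ (Nat.factorial ⌈α⌉₊) * Real.exp z := by
    have := Real.pow_div_factorial_le_exp z hz ⌈α⌉₊
    rwa [div_le_iff₀' (by positivity)] at this
  have h3 : z ^ α ≤ 1 + z ^ ⌈α⌉₊ := by
    rcases le_total z 1 with h | h
    · have := Real.rpow_le_one hz h hα
      have : 0 ≤ z ^ ⌈α⌉₊ := by positivity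
      linarith
    · have := Real.rpow_le_rpow_of_exponent_le h (Nat.le_ceil α)
      rw [Real.rpow_natCast] at this
      linarith
  linarith

theorem one_add_rpow_le {α x : ℝ} (hα : 0 ≤ α) (hx : 0 ≤ x) :
    (1 + x) ^ α ≤ 2 ^ α * (1 + x ^ α) := by
  have h0 : 0 ≤ x ^ α := by positivity
  have h2 : (0 : ℝ) ≤ 2 ^ α := by positivity
  rcases le_total x 1 with h | h
  · calc (1 + x) ^ α ≤ 2 ^ α := Real.rpow_le_rpow (by positivity) (by linarith) hα
      _ ≤ _ := by nlinarith
  · calc (1 + x) ^ α ≤ (2 * x) ^ α := Real.rpow_le_rpow (by positivity) (by linarith) hα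
      _ = 2 ^ α * x ^ α := Real.mul_rpow (by norm_num) hx
      _ ≤ _ := by nlinarith

theorem le_one_add_rpow {α x : ℝ} (hα : 1 ≤ α) (hx : 0 ≤ x) : x ≤ 1 + x ^ α := by
  have h0 : 0 ≤ x ^ α := by positivity
  rcases le_total x 1 with h | h
  · linarith
  · have := Real.rpow_le_rpow_of_exponent_le h hα
    rw [Real.rpow_one] at this
    linarith

theorem exists_abs_sub_le_of_tendsto_wt {α : ℝ} {f : ℝ → ℝ}
    (hfc : ContinuousOn f (Set.Ici 0))
    (hf0 : Tendsto (fun x => wt α x * f x) atTop (nhds 0)) {ε : ℝ} (hε : 0 < ε) :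
    ∃ D, 0 ≤ D ∧ ∀ x y, 0 ≤ x → 0 ≤ y →
      |f y - f x| ≤ ε + ε * (1 + x ^ α) + ε * (1 + y ^ α) + D * (y - x) ^ 2 := by
  obtain ⟨R₀, hR₀⟩ := eventually_atTop.1 ((Metric.tendsto_nhds.1 hf0) ε hε)
  set R := max R₀ 0
  have hR : ∀ z, R ≤ z → |f z| ≤ ε * (1 + z ^ α) := fun z hz => by
    have hz0 : 0 ≤ z := (le_max_right _ _).trans hz
    have h := hR₀ z ((le_max_left _ _).trans hz)
    have hp : 0 < 1 + z ^ α := by positivity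
    rw [Real.dist_eq, sub_zero, wt, abs_mul, abs_of_pos (by positivity : 0 < 1 / (1 + z ^ α)),
      one_div, inv_mul_lt_iff₀ hp] at h
    linarith
  have hsub : Set.Icc 0 (R + 1) ⊆ Set.Ici (0 : ℝ) := fun z hz => hz.1
  obtain ⟨K₀, hK₀⟩ := isCompact_Icc.exists_bound_of_continuousOn (hfc.mono hsub)
  set K := max K₀ 0
  have hK : ∀ z, 0 ≤ z → |f z| ≤ K + ε * (1 + z ^ α) := fun z hz => by
    rcases le_total z R with h | h
    · have h1 := hK₀ z ⟨hz, by linarith⟩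
      rw [Real.norm_eq_abs] at h1
      have h2 : 0 ≤ ε * (1 + z ^ α) := by positivity
      linarith [le_max_left K₀ 0]
    · linarith [hR z h, le_max_right K₀ 0]
  obtain ⟨δ₀, hδ₀, hδ₀'⟩ := Metric.uniformContinuousOn_iff.1
    (isCompact_Icc.uniformContinuousOn_of_continuous (hfc.mono hsub)) ε hε
  set δ := min δ₀ 1
  have hδ : 0 < δ := lt_min hδ₀ one_pos
  have hK0 : 0 ≤ K := le_max_right _ _
  refine ⟨2 * K / δ ^ 2, by positivity, fun x y hx hy => ?_⟩
  have hD : 0 ≤ 2 * K / δ ^ 2 * (y - x) ^ 2 := by positivity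
  have hwx : 0 ≤ ε * (1 + x ^ α) := by positivity
  have hwy : 0 ≤ ε * (1 + y ^ α) := by positivity
  have htri := abs_sub (f y) (f x)
  rcases lt_or_ge |y - x| δ with h | h
  · by_cases hle : x ≤ R + 1 ∧ y ≤ R + 1
    · have := hδ₀' y ⟨hy, hle.2⟩ x ⟨hx, hle.1⟩ (h.trans_le (min_le_left _ _))
      rw [Real.dist_eq] at this
      linarith
    · have h1 := abs_lt.1 (h.trans_le (min_le_right _ _))
      have h2 : R ≤ x ∧ R ≤ y := by
        by_contra hcon
        apply hle
        rcases not_and_or.1 hcon with h3 | h3 <;> constructor <;> linarith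
      linarith [hR x h2.1, hR y h2.2]
  · have h1 : δ ^ 2 ≤ (y - x) ^ 2 := by
      rw [← sq_abs (y - x)]
      gcongr
    have h2 : 2 * K ≤ 2 * K / δ ^ 2 * (y - x) ^ 2 := by
      rw [div_mul_eq_mul_div, le_div_iff₀ (by positivity)]
      gcongr
    linarith [hK x hx, hK y hy]

/-- For `α ≥ 1` and every `f ∈ C_∞^{w_α}([0,∞))`,
`lim_{n→∞} ‖𝒫ₙ f − f‖_{∞,w_α} = 0`. -/
theorem szasz_weighted_convergence (α : ℝ) (hα : 1 ≤ α) (f : ℝ → ℝ)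
    (hfc : ContinuousOn f (Set.Ici 0))
    (hf0 : Tendsto (fun x => wt α x * f x) atTop (nhds 0)) :
    ∀ ε > (0 : ℝ), ∃ N : ℕ, ∀ n ≥ N, ∀ x ≥ (0 : ℝ),
      wt α x * |szasz n f x - f x| < ε := by
  intro ε hε
  have hα0 : 0 ≤ α := by linarith
  obtain ⟨C, hC, hCz⟩ := exists_rpow_le_mul_exp hα0
  set L : ℝ := 3 + C * 2 ^ α * Real.exp 2
  have hL : 0 < L := by positivity
  set η : ℝ := ε / (2 * L)
  have hη : 0 < η := by positivity
  obtain ⟨D, hD, hfD⟩ := exists_abs_sub_le_of_tendsto_wt hfc hf0 hη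
  obtain ⟨N, hN⟩ := exists_nat_gt (2 * D / ε)
  refine ⟨N, fun n hn x hx => ?_⟩
  have hn' : 2 * D / ε < n := hN.trans_le (by exact_mod_cast hn)
  have hn0 : 0 < (n : ℝ) := lt_of_le_of_lt (by positivity) hn'
  have hnpos : 0 < n := by exact_mod_cast hn0
  have hDn : D / n < ε / 2 := by
    rw [div_lt_iff₀ hε] at hn'
    rw [div_lt_iff₀ hn0]
    linarith
  obtain ⟨s, hs, hsum⟩ := exists_hasSum_poissonWeight_mul_exp hnpos hx
  have htot := (((hasSum_poissonWeight (n * x)).mul_right (3 * η + η * x ^ α)).add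
    (hsum.mul_right (η * (C * (1 + x) ^ α)))).add
    ((hasSum_poissonWeight_mul_sub_sq hnpos x).mul_right D)
  have hmain := abs_szasz_sub_le_s6 (f := f) (n := n)
    (g := fun y => (3 * η + η * x ^ α) + Real.exp (y / (1 + x)) * (η * (C * (1 + x) ^ α))
      + (y - x) ^ 2 * D) hx
    (htot.of_forall_eq (fun k => by ring) rfl)
    (fun y hy => by
      have h1 := hfD x y hx hy
      have h2 := hCz (y / (1 + x)) (by positivity)
      rw [Real.div_rpow hy (by positivity), div_le_iff₀ (by positivity)] at h2
      have h3 := mul_le_mul_of_nonneg_left h2 hη.le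
      linarith)
  have hW : 0 < 1 + x ^ α := by positivity
  rw [wt, one_div, inv_mul_lt_iff₀ hW]
  have h1 : s * (η * (C * (1 + x) ^ α)) ≤
      Real.exp 2 * (η * (C * (2 ^ α * (1 + x ^ α)))) := by
    have := one_add_rpow_le hα0 hx
    gcongr
  have h2 : x / n * D ≤ (1 + x ^ α) * (D / n) := by
    rw [div_mul_eq_mul_div, mul_div_assoc]
    have := le_one_add_rpow hα hx
    gcongr
  have h3 : 3 * η + η * x ^ α ≤ 3 * η * (1 + x ^ α) := by
    have : 0 ≤ η * x ^ α := by positivity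
    linarith
  have h4 : η * L = ε / 2 := by
    simp only [η]
    field_simp
  calc |szasz n f x - f x| ≤ (1 + x ^ α) * (η * L + D / n) := by
        simp only [L]
        linarith
    _ < (1 + x ^ α) * ε := by
        gcongr
        linarith
end

section
/- Let U be a real Banach space, (Tₙ)_{n≥1} continuous linear operators on U with ‖Tₙ‖ ≤ 1, and let (S_t)_{t≥0} be a family of continuous linear operators on U with S_0 the identity, S_{t+s} = S_t ∘ S_s, ‖S_t‖ ≤ 1, t ↦ S_t f continuous for each f ∈ U, and such that Tₙ^{⌊nt⌋}g → S_t g for all g ∈ U and t ≥ 0. Let D be a dense linear subspace of U, A : D → U linear with n(Tₙf − f) → Af for all f ∈ D, and let φₙ, ψₙ : D → [0,∞) be seminorms satisfying ‖n(Tₙf − f)‖ ≤ φₙ(f) and ‖n(Tₙf − f) − Af‖ ≤ ψₙ(f) for all f ∈ D and n ≥ 1. Then for every t ≥ 0, every n ≥ 1, and every f ∈ D such that S_s f ∈ D for all s ≥ 0 and s ↦ ψₙ(S_s f) is integrable on [0,t], one has ‖Tₙ^{⌊nt⌋}f − S_t f‖ ≤ √(t/n)·φₙ(f) + (1/n)·φₙ(f)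 + ∫₀ᵗ ψₙ(S_s f) ds. -/
open Filter

/-- Powers of a contraction are contractions. -/
theorem norm_pow_apply_le_of_norm_le_one {U : Type*} [NormedAddCommGroup U] [NormedSpace ℝ U]
    {T : U →L[ℝ] U} (hT : ‖T‖ ≤ 1) (k : ℕ) (x : U) : ‖(T ^ k) x‖ ≤ ‖x‖ := by
  induction k with
  | zero => simp
  | succ k ih =>
    rw [pow_succ', mul_apply_eq_comp]
    exact (T.le_of_opNorm_le hT _).trans (by simpa using ih)

theorem norm_pow_apply_sub_self_le {U : Type*} [NormedAddCommGroup U] [NormedSpace ℝ U]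
    {T : U →L[ℝ] U} (hT : ‖T‖ ≤ 1) (k : ℕ) (x : U) : ‖(T ^ k) x - x‖ ≤ k * ‖T x - x‖ := by
  induction k with
  | zero => simp
  | succ k ih =>
    have h : (T ^ (k + 1)) x - x = (T ^ k) (T x - x) + ((T ^ k) x - x) := by
      rw [pow_succ, mul_apply_eq_comp, map_sub]; abel
    rw [h]
    rw [Nat.cast_succ]
    linarith [norm_add_le ((T ^ k) (T x - x)) ((T ^ k) x - x),
      norm_pow_apply_le_of_norm_le_one hT k (T x - x)]

theorem norm_pow_apply_sub_pow_apply_le {U : Type*} [NormedAddCommGroup U] [NormedSpace ℝ U]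
    {T : U →L[ℝ] U} (hT : ‖T‖ ≤ 1) (j k : ℕ) (x : U) :
    ‖(T ^ j) x - (T ^ k) x‖ ≤ |(j : ℝ) - k| * ‖T x - x‖ := by
  wlog h : k ≤ j generalizing j k
  · rw [norm_sub_rev, abs_sub_comm]
    exact this k j (le_of_not_ge h)
  obtain ⟨m, rfl⟩ := Nat.exists_eq_add_of_le h
  have h : (T ^ (k + m)) x - (T ^ k) x = (T ^ k) ((T ^ m) x - x) := by
    rw [pow_add, mul_apply_eq_comp, map_sub]
  rw [h]
  refine (norm_pow_apply_le_of_norm_le_one hT k _).trans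
    ((norm_pow_apply_sub_self_le hT m x).trans (le_of_eq ?_))
  push_cast
  rw [add_sub_cancel_left, abs_of_nonneg (Nat.cast_nonneg m)]

/-- A first-order Taylor estimate for the powers of a contraction. -/
theorem norm_pow_apply_sub_sub_smul_le {U : Type*} [NormedAddCommGroup U] [NormedSpace ℝ U]
    {T : U →L[ℝ] U} (hT : ‖T‖ ≤ 1) (x y : U) (c : ℝ) (k : ℕ)
    (hc : ∀ j < k, ‖(T ^ j) y - y‖ ≤ c) :
    ‖(T ^ k) x - x - (k : ℝ) • y‖ ≤ k * (‖T x - x - y‖ + c) := by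
  induction k with
  | zero => simp
  | succ k ih =>
    have h : (T ^ (k + 1)) x - x - ((k + 1 : ℕ) : ℝ) • y =
        (T ^ k) (T x - x - y) + ((T ^ k) y - y) + ((T ^ k) x - x - (k : ℝ) • y) := by
      rw [pow_succ, mul_apply_eq_comp, map_sub, map_sub]
      push_cast
      rw [add_smul, one_smul]; abel
    rw [h]
    rw [Nat.cast_succ]
    linarith [norm_add₃_le (a := (T ^ k) (T x - x - y)) (b := (T ^ k) y - y)
      (c := (T ^ k) x - x - (k : ℝ) • y),
      norm_pow_apply_le_of_norm_le_one hT k (T x - x - y), hc k (Nat.lt_succ_self k),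
      ih fun j hj => hc j (hj.trans (Nat.lt_succ_self k))]

/-- The quantitative form of differentiability at `0` of the limit semigroup. -/
theorem norm_sub_sub_smul_le_of_tendsto_pow {U : Type*} [NormedAddCommGroup U] [NormedSpace ℝ U]
    {T : ℕ → U →L[ℝ] U} (hT : ∀ n, ‖T n‖ ≤ 1) {f f' g g' z : U} {h : ℝ} (hh : 0 ≤ h)
    (hz : Tendsto (fun n : ℕ => ((T n) ^ ⌊(n : ℝ) * h⌋₊) f) atTop (nhds z))
    (hf : Tendsto (fun n : ℕ => (n : ℝ) • (T n f - f)) atTop (nhds f'))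
    (hg : Tendsto (fun n : ℕ => (n : ℝ) • (T n g - g)) atTop (nhds g')) :
    ‖z - f - h • f'‖ ≤ h * (2 * ‖f' - g‖ + h * ‖g'‖) := by
  have hfloor : Tendsto (fun n : ℕ => ((⌊(n : ℝ) * h⌋₊ : ℝ) / n)) atTop (nhds h) := by
    simpa [mul_comm, Function.comp_def] using
      (tendsto_nat_floor_mul_div_atTop hh).comp (tendsto_natCast_atTop_atTop (R := ℝ))
  have hL : Tendsto (fun n : ℕ => ‖((T n) ^ ⌊(n : ℝ) * h⌋₊) f - f -
      ((⌊(n : ℝ) * h⌋₊ : ℝ) / n) • f'‖) atTop (nhds ‖z - f - h • f'‖) :=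
    ((hz.sub_const f).sub (hfloor.smul_const f')).norm
  have hR : Tendsto (fun n : ℕ => ((⌊(n : ℝ) * h⌋₊ : ℝ) / n) *
      (‖(n : ℝ) • (T n f - f) - f'‖ + (2 * ‖f' - g‖ +
        ((⌊(n : ℝ) * h⌋₊ : ℝ) / n) * ‖(n : ℝ) • (T n g - g)‖))) atTop
      (nhds (h * (‖f' - f'‖ + (2 * ‖f' - g‖ + h * ‖g'‖)))) :=
    hfloor.mul ((hf.sub_const f').norm.add ((hfloor.mul hg.norm).const_add _))
  rw [sub_self, norm_zero, zero_add] at hR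
  refine le_of_tendsto_of_tendsto hL hR ?_
  filter_upwards [eventually_ge_atTop 1] with n hn
  have hn0 : (0 : ℝ) < n := by exact_mod_cast hn
  set k := ⌊(n : ℝ) * h⌋₊
  set c : ℝ := 2 * ‖f' - g‖ + (k / n) * ‖(n : ℝ) • (T n g - g)‖ with hc
  have hbound : ∀ j < k, ‖((T n) ^ j) ((n : ℝ)⁻¹ • f') - (n : ℝ)⁻¹ • f'‖ ≤ (n : ℝ)⁻¹ * c := by
    intro j hj
    rw [map_smul, ← smul_sub, norm_smul, Real.norm_of_nonneg (inv_nonneg.2 hn0.le)]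
    gcongr
    have h1 : ((T n) ^ j) f' - f' =
        ((T n) ^ j) (f' - g) + (((T n) ^ j) g - g) + (g - f') := by
      rw [map_sub]; abel
    have h2 : (k / n : ℝ) * ‖(n : ℝ) • (T n g - g)‖ = k * ‖T n g - g‖ := by
      rw [norm_smul, Real.norm_of_nonneg hn0.le]; field_simp
    have h3 : (j : ℝ) * ‖T n g - g‖ ≤ k * ‖T n g - g‖ := by gcongr
    rw [h1, hc, h2]
    linarith [norm_add₃_le (a := ((T n) ^ j) (f' - g)) (b := ((T n) ^ j) g - g) (c := g - f'),
      norm_pow_apply_le_of_norm_le_one (hT n) j (f' - g),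
      norm_pow_apply_sub_self_le (hT n) j g, norm_sub_rev g f']
  have hmain := norm_pow_apply_sub_sub_smul_le (hT n) f ((n : ℝ)⁻¹ • f') _ k hbound
  have h4 : ‖T n f - f - (n : ℝ)⁻¹ • f'‖ = (n : ℝ)⁻¹ * ‖(n : ℝ) • (T n f - f) - f'‖ := by
    rw [← Real.norm_of_nonneg (inv_nonneg.2 hn0.le), ← norm_smul, smul_sub,
      Real.norm_of_nonneg (inv_nonneg.2 hn0.le), inv_smul_smul₀ hn0.ne']
  rw [h4, smul_smul, ← div_eq_mul_inv] at hmain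
  refine hmain.trans (le_of_eq ?_)
  ring

/-- The weight identity behind the moments of the Poisson distribution. -/
theorem HasSum.natCast_mul_mul_pow_div_factorial {x s : ℝ} {c : ℕ → ℝ}
    (h : HasSum (fun j => c (j + 1) * (x ^ j / j.factorial)) s) :
    HasSum (fun j : ℕ => (j * c j) * (x ^ j / j.factorial)) (x * s) := by
  rw [← hasSum_nat_add_iff' 1]
  simp only [Finset.range_one, Finset.sum_singleton, Nat.cast_zero, zero_mul, sub_zero]
  refine (h.mul_left x).congr_fun fun j => ?_
  rw [Nat.factorial_succ, pow_succ]
  push_cast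
  field_simp

/-- The variance of the Poisson distribution. -/
theorem hasSum_sq_sub_mul_pow_div_factorial (x : ℝ) :
    HasSum (fun j : ℕ => ((j : ℝ) - x) ^ 2 * (x ^ j / j.factorial)) (x * Real.exp x) := by
  have h0 : HasSum (fun j : ℕ => x ^ j / j.factorial) (Real.exp x) := by
    rw [Real.exp_eq_exp_ℝ]; exact NormedSpace.expSeries_div_hasSum_exp x
  have h1 : HasSum (fun j : ℕ => ((j : ℝ) * 1) * (x ^ j / j.factorial)) (x * Real.exp x) :=
    HasSum.natCast_mul_mul_pow_div_factorial (c := fun _ => 1) (by simpa using h0)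
  have h2 : HasSum (fun j : ℕ => ((j : ℝ) * j) * (x ^ j / j.factorial))
      (x * (x * Real.exp x + Real.exp x)) := by
    refine HasSum.natCast_mul_mul_pow_div_factorial (c := fun j => (j : ℝ))
      ((h1.add h0).congr_fun fun j => ?_)
    push_cast; ring
  have h3 := ((h2.sub (h1.mul_left (2 * x))).add (h0.mul_left (x ^ 2))).congr_fun
    (g := fun j : ℕ => ((j : ℝ) - x) ^ 2 * (x ^ j / j.factorial)) fun j => by ring
  have hs : x * (x * Real.exp x + Real.exp x) - 2 * x * (x * Real.exp x) + x ^ 2 * Real.exp x =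
      x * Real.exp x := by ring
  rwa [hs] at h3

theorem exp_smul_sub_one {U : Type*} [NormedAddCommGroup U] [NormedSpace ℝ U] [CompleteSpace U]
    (T : U →L[ℝ] U) (x : ℝ) :
    NormedSpace.exp (x • (T - 1)) = Real.exp (-x) • NormedSpace.exp (x • T) := by
  let _ : NormedAlgebra ℚ (U →L[ℝ] U) := NormedAlgebra.restrictScalars ℚ ℝ _
  have h : x • (T - 1) = algebraMap ℝ (U →L[ℝ] U) (-x) + x • T := by
    rw [Algebra.algebraMap_eq_smul_one, smul_sub, neg_smul]; abel
  rw [h, NormedSpace.exp_add_of_commute (Algebra.commutes _ _), ← NormedSpace.algebraMap_exp_comm,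
    ← Real.exp_eq_exp_ℝ, ← Algebra.smul_def]

theorem hasSum_exp_smul_apply {U : Type*} [NormedAddCommGroup U] [NormedSpace ℝ U]
    [CompleteSpace U] (T : U →L[ℝ] U) (x : ℝ) (f : U) :
    HasSum (fun j : ℕ => (x ^ j / j.factorial) • (T ^ j) f) (NormedSpace.exp (x • T) f) := by
  have h := (ContinuousLinearMap.apply ℝ U f).hasSum
    (NormedSpace.exp_series_hasSum_exp' (𝕂 := ℝ) (x • T))
  refine h.congr_fun fun j => ?_
  simp [smul_pow, smul_smul, div_eq_inv_mul]

theorem norm_exp_smul_sub_one_apply_le {U : Type*} [NormedAddCommGroup U] [NormedSpace ℝ U]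
    [CompleteSpace U] {T : U →L[ℝ] U} (hT : ‖T‖ ≤ 1) {x : ℝ} (hx : 0 ≤ x) (f : U) :
    ‖NormedSpace.exp (x • (T - 1)) f‖ ≤ ‖f‖ := by
  have h0 : HasSum (fun j : ℕ => x ^ j / j.factorial) (Real.exp x) := by
    rw [Real.exp_eq_exp_ℝ]; exact NormedSpace.expSeries_div_hasSum_exp x
  have h : ‖NormedSpace.exp (x • T) f‖ ≤ Real.exp x * ‖f‖ := by
    refine (hasSum_exp_smul_apply T x f).norm_le_of_bounded (h0.mul_right ‖f‖) fun j => ?_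
    rw [norm_smul, Real.norm_of_nonneg (by positivity)]
    gcongr
    exact norm_pow_apply_le_of_norm_le_one hT j f
  rw [exp_smul_sub_one, smul_apply, norm_smul,
    Real.norm_of_nonneg (Real.exp_pos _).le, Real.exp_neg]
  rw [inv_mul_le_iff₀ (Real.exp_pos x)]
  exact h

/-- **Chernoff's `√k` lemma.** -/
theorem norm_pow_apply_sub_exp_smul_sub_one_apply_le {U : Type*} [NormedAddCommGroup U]
    [NormedSpace ℝ U] [CompleteSpace U] {T : U →L[ℝ] U} (hT : ‖T‖ ≤ 1) (k : ℕ) (f : U) :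
    ‖(T ^ k) f - NormedSpace.exp ((k : ℝ) • (T - 1)) f‖ ≤ √k * ‖T f - f‖ := by
  rcases Nat.eq_zero_or_pos k with rfl | hk
  · simp
  have hk0 : (0 : ℝ) < √k := Real.sqrt_pos.2 (by exact_mod_cast hk)
  have hsq : √(k : ℝ) ^ 2 = k := Real.sq_sqrt (Nat.cast_nonneg k)
  have h0 : HasSum (fun j : ℕ => (k : ℝ) ^ j / j.factorial) (Real.exp k) := by
    rw [Real.exp_eq_exp_ℝ]; exact NormedSpace.expSeries_div_hasSum_exp _
  have hdiff := (h0.smul_const ((T ^ k) f)).sub (hasSum_exp_smul_apply T k f)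
  have hmaj := (((hasSum_sq_sub_mul_pow_div_factorial k).mul_left ((2 * √(k : ℝ))⁻¹)).add
    (h0.mul_left (√(k : ℝ) / 2))).mul_right ‖T f - f‖
  have h : ‖Real.exp k • (T ^ k) f - NormedSpace.exp ((k : ℝ) • T) f‖ ≤
      Real.exp k * (√k * ‖T f - f‖) := by
    refine (hdiff.norm_le_of_bounded hmaj fun j => ?_).trans (le_of_eq ?_)
    · rw [← smul_sub, norm_smul, Real.norm_of_nonneg (by positivity)]
      have hyoung : |(j : ℝ) - k| ≤ (2 * √(k : ℝ))⁻¹ * ((j : ℝ) - k) ^ 2 + √(k : ℝ) / 2 := by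
        rw [← sq_abs]
        have h1 : (2 * √(k : ℝ))⁻¹ * |(j : ℝ) - k| ^ 2 + √(k : ℝ) / 2 - |(j : ℝ) - k| =
            (2 * √(k : ℝ))⁻¹ * (|(j : ℝ) - k| - √(k : ℝ)) ^ 2 := by
          field_simp; ring
        have h2 : 0 ≤ (2 * √(k : ℝ))⁻¹ * (|(j : ℝ) - k| - √(k : ℝ)) ^ 2 := by positivity
        linarith
      calc (k : ℝ) ^ j / j.factorial * ‖(T ^ k) f - (T ^ j) f‖
          ≤ (k : ℝ) ^ j / j.factorial *
            (((2 * √(k : ℝ))⁻¹ * ((j : ℝ) - k) ^ 2 + √(k : ℝ) / 2) * ‖T f - f‖) := by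
            gcongr
            rw [norm_sub_rev]
            exact (norm_pow_apply_sub_pow_apply_le hT j k f).trans (by gcongr)
        _ = _ := by ring
    · nth_rewrite 2 [← hsq]
      field_simp
      ring
  have h1 : (T ^ k) f - NormedSpace.exp ((k : ℝ) • (T - 1)) f =
      Real.exp (-k) • (Real.exp k • (T ^ k) f - NormedSpace.exp ((k : ℝ) • T) f) := by
    rw [exp_smul_sub_one, smul_sub, smul_smul, ← Real.exp_add, neg_add_cancel, Real.exp_zero,
      one_smul, smul_apply]
  rw [h1, norm_smul, Real.norm_of_nonneg (Real.exp_pos _).le, Real.exp_neg,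
    inv_mul_le_iff₀ (Real.exp_pos _)]
  exact h

theorem norm_exp_smul_sub_one_apply_sub_le {U : Type*} [NormedAddCommGroup U] [NormedSpace ℝ U]
    [CompleteSpace U] {T : U →L[ℝ] U} (hT : ‖T‖ ≤ 1) {x y : ℝ} (hx : 0 ≤ x) (hxy : x ≤ y) (f : U) :
    ‖NormedSpace.exp (y • (T - 1)) f - NormedSpace.exp (x • (T - 1)) f‖ ≤
      (y - x) * ‖T f - f‖ := by
  rw [mul_comm]
  refine norm_image_sub_le_of_norm_deriv_le_segment'
    (f := fun r => NormedSpace.exp (r • (T - 1)) f)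
    (f' := fun r => NormedSpace.exp (r • (T - 1)) (T f - f))
    (fun r _ => ?_) (fun r hr => ?_) y ⟨hxy, le_rfl⟩
  · simpa using ((hasDerivAt_exp_smul_const (𝕂 := ℝ) (T - 1) r).clm_apply
      (hasDerivAt_const r f)).hasDerivWithinAt
  · exact norm_exp_smul_sub_one_apply_le hT (hx.trans hr.1) _

/-- A curve whose first-order Taylor remainder at `0` is bounded in terms of approximations of the
slope from a dense set is right differentiable at `0`. -/
theorem hasDerivWithinAt_zero_of_norm_sub_sub_smul_le {U : Type*} [NormedAddCommGroup U]
    [NormedSpace ℝ U] {u : ℝ → U} {u' : U} (D : Set U) (hD : Dense D) (C : U → ℝ)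
    (h : ∀ r, 0 ≤ r → ∀ g ∈ D, ‖u r - u 0 - r • u'‖ ≤ r * (2 * ‖u' - g‖ + r * C g)) :
    HasDerivWithinAt u u' (Set.Ici 0) 0 := by
  rw [hasDerivWithinAt_iff_isLittleO, Asymptotics.isLittleO_iff]
  intro ε hε
  obtain ⟨g, hgD, hg⟩ := hD.exists_dist_lt u' (ε := ε / 4) (by positivity)
  rw [dist_eq_norm] at hg
  have hev : ∀ᶠ r : ℝ in nhds 0, r * C g < ε / 2 :=
    (by fun_prop : Continuous fun r : ℝ => r * C g).continuousAt.eventually_lt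
      continuousAt_const (by simpa using half_pos hε)
  filter_upwards [mem_nhdsWithin_of_mem_nhds hev, self_mem_nhdsWithin] with r hr hr0
  have hr0 : 0 ≤ r := hr0
  rw [sub_zero, Real.norm_of_nonneg hr0, mul_comm ε]
  refine (h r hr0 g hgD).trans ?_
  gcongr
  linarith

/-- **Campiti–Tacelli rate of convergence in Trotter's approximation theorem.**
With `(Tₙ)` contractions on a real Banach space `U`, `(S_t)` a contraction `C₀`-semigroup with
`Tₙ^{⌊nt⌋} g → S_t g`, `D ⊆ U` a dense subspace, `A : D → U` linear with
`n(Tₙ f − f) → A f` on `D`, and seminorms `φₙ, ψₙ` on `D` with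
`‖n(Tₙ f − f)‖ ≤ φₙ(f)` and `‖n(Tₙ f − f) − A f‖ ≤ ψₙ(f)`, one has, for `t ≥ 0`, `n ≥ 1` and
`f ∈ D` with `S_s f ∈ D` for all `s ≥ 0` and `s ↦ ψₙ(S_s f)` integrable on `[0,t]`:
`‖Tₙ^{⌊nt⌋} f − S_t f‖ ≤ √(t/n)·φₙ(f) + (1/n)·φₙ(f) + ∫₀ᵗ ψₙ(S_s f) ds`. -/
theorem trotter_rate (U : Type*) [NormedAddCommGroup U] [NormedSpace ℝ U] [CompleteSpace U]
    (T : ℕ → U →L[ℝ] U) (hT : ∀ n, ‖T n‖ ≤ 1)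
    (S : ℝ → U →L[ℝ] U)
    (hS0 : S 0 = ContinuousLinearMap.id ℝ U)
    (hSsemi : ∀ s ≥ (0 : ℝ), ∀ t ≥ (0 : ℝ), S (t + s) = (S t).comp (S s))
    (hScontr : ∀ t ≥ (0 : ℝ), ‖S t‖ ≤ 1)
    (hScont : ∀ g : U, ContinuousOn (fun t => S t g) (Set.Ici 0))
    (hSlim : ∀ t ≥ (0 : ℝ), ∀ g : U,
      Tendsto (fun n : ℕ => ((T n) ^ ⌊(n : ℝ) * t⌋₊) g) atTop (nhds (S t g)))
    (D : Submodule ℝ U) (hD : Dense (D : Set U))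
    (A : D →ₗ[ℝ] U)
    (hconv : ∀ f : D, Tendsto (fun n : ℕ => (n : ℝ) • (T n (f : U) - (f : U)))
      atTop (nhds (A f)))
    (φ ψ : ℕ → Seminorm ℝ D)
    (hφ : ∀ n : ℕ, 1 ≤ n → ∀ f : D, ‖(n : ℝ) • (T n (f : U) - (f : U))‖ ≤ φ n f)
    (hψ : ∀ n : ℕ, 1 ≤ n → ∀ f : D, ‖(n : ℝ) • (T n (f : U) - (f : U)) - A f‖ ≤ ψ n f)
    (t : ℝ) (ht : 0 ≤ t) (n : ℕ) (hn : 1 ≤ n) (f : D)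
    (g : ℝ → D) (hg : ∀ s : ℝ, 0 ≤ s → (g s : U) = S s (f : U))
    (hint : IntervalIntegrable (fun s => (ψ n (g s) : ℝ)) MeasureTheory.volume 0 t) :
    ‖((T n) ^ ⌊(n : ℝ) * t⌋₊) (f : U) - S t (f : U)‖
      ≤ Real.sqrt (t / n) * φ n f + (1 / n) * φ n f + ∫ s in (0 : ℝ)..t, (ψ n (g s) : ℝ) := by
  have hn0 : (0 : ℝ) < n := by exact_mod_cast hn
  have hderiv0 (x : D) : HasDerivWithinAt (fun r => S r (x : U)) (A x) (Set.Ici 0) 0 := by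
    refine hasDerivWithinAt_zero_of_norm_sub_sub_smul_le (D : Set U) hD
      (fun y => ‖limUnder atTop fun m : ℕ => (m : ℝ) • (T m y - y)‖) fun r hr y hy => ?_
    rw [(hconv ⟨y, hy⟩).limUnder_eq]
    simpa [hS0] using norm_sub_sub_smul_le_of_tendsto_pow hT hr (hSlim r hr x) (hconv x)
      (hconv ⟨y, hy⟩)
  have hshift {s : ℝ} {v : U} (h : HasDerivWithinAt (fun r => S (s + r) (f : U)) v (Set.Ici 0) 0) :
      HasDerivWithinAt (fun r => S r (f : U)) v (Set.Ici s) s := by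
    have h1 : HasDerivWithinAt (fun r => S (s + r) (f : U)) v (Set.Ici 0) (s - s) := by
      rwa [sub_self]
    have h2 := HasDerivWithinAt.scomp (h := fun r => r - s) (s := Set.Ici s) s h1
      ((hasDerivAt_id s).sub_const s).hasDerivWithinAt fun r hr =>
        Set.mem_Ici.2 (sub_nonneg.2 hr)
    simpa [Function.comp_def] using h2
  have hderivA (s : ℝ) (hs : 0 ≤ s) :
      HasDerivWithinAt (fun r => S r (f : U)) (A (g s)) (Set.Ici s) s := by
    refine hshift ((hderiv0 (g s)).congr (fun r hr => ?_) ?_)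
    · rw [hg s hs, add_comm, hSsemi s hs r hr, ContinuousLinearMap.comp_apply]
    · simp [hg s hs, hS0]
  have hderivS (s : ℝ) (hs : 0 ≤ s) :
      HasDerivWithinAt (fun r => S r (f : U)) (S s (A f)) (Set.Ici s) s := by
    refine hshift (((S s).hasFDerivAt.comp_hasDerivWithinAt 0 (hderiv0 f)).congr
      (fun r hr => ?_) ?_)
    · rw [hSsemi r hr s hs]; rfl
    · simp [hS0]
  have hAS (s : ℝ) (hs : 0 ≤ s) : A (g s) = S s (A f) :=
    (uniqueDiffWithinAt_Ici s).eq_deriv _ (hderivA s hs) (hderivS s hs)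
  set E : ℝ → U →L[ℝ] U := fun r => NormedSpace.exp (r • ((n : ℝ) • (T n - 1))) with hE
  have hEn (r : ℝ) : E r = NormedSpace.exp ((r * n) • (T n - 1)) := by rw [hE, mul_smul]
  have hEderiv (s : ℝ) : HasDerivAt (fun s => E (t - s))
      (-(E (t - s) * ((n : ℝ) • (T n - 1)))) s := by
    have h1 := HasDerivAt.scomp (h := fun s => t - s) s
      (hasDerivAt_exp_smul_const (𝕂 := ℝ) ((n : ℝ) • (T n - 1)) (t - s))
      ((hasDerivAt_id s).const_sub t)
    rwa [neg_one_smul] at h1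
  have hEcont : Continuous fun s => E (t - s) :=
    continuous_iff_continuousAt.2 fun s => (hEderiv s).continuousAt
  have hScont' (x : U) : ContinuousOn (fun s => S s x) (Set.uIcc 0 t) :=
    (hScont x).mono fun s hs => (Set.uIcc_of_le ht ▸ hs).1
  set w : ℝ → U := fun s => E (t - s) (S s (A f) - (n : ℝ) • (T n (S s f) - S s f)) with hw
  have hwcont : ContinuousOn w (Set.uIcc 0 t) :=
    hEcont.continuousOn.clm_apply ((hScont' _).sub
      ((((T n).continuous.comp_continuousOn (hScont' f)).sub (hScont' f)).const_smul (n : ℝ)))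
  have hft : ∫ s in (0 : ℝ)..t, w s = E (t - t) (S t f) - E (t - 0) (S 0 f) := by
    refine intervalIntegral.integral_eq_sub_of_hasDeriv_right
      (f := fun s => E (t - s) (S s f)) (hEcont.continuousOn.clm_apply (hScont' f))
      (fun s hs => ?_) hwcont.intervalIntegrable
    rw [min_eq_left ht, max_eq_right ht] at hs
    convert ((hEderiv s).hasDerivWithinAt (s := Set.Ioi s)).clm_apply
      ((hderivS s hs.1.le).mono Set.Ioi_subset_Ici_self) using 1
    simp only [hw, map_sub, neg_apply, mul_apply_eq_comp,
      smul_apply, sub_apply,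
      one_apply_eq_self]
    abel
  have hwbound (s : ℝ) (hs : s ∈ Set.Ioc 0 t) : ‖w s‖ ≤ ψ n (g s) := by
    have h1 := hψ n hn (g s)
    rw [hAS s hs.1.le, hg s hs.1.le, norm_sub_rev] at h1
    refine le_trans ?_ h1
    rw [hw]
    simp only [hEn]
    exact norm_exp_smul_sub_one_apply_le (hT n) (mul_nonneg (sub_nonneg.2 hs.2) hn0.le) _
  have hES : ‖E t f - S t f‖ ≤ ∫ s in (0 : ℝ)..t, (ψ n (g s) : ℝ) := by
    have h1 : E (t - t) (S t f) - E (t - 0) (S 0 f) = S t f - E t f := by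
      simp [hE, hS0]
    rw [norm_sub_rev, ← h1, ← hft]
    exact intervalIntegral.norm_integral_le_of_norm_le ht
      (Eventually.of_forall hwbound) hint
  set k := ⌊(n : ℝ) * t⌋₊
  have hk : (k : ℝ) ≤ n * t := Nat.floor_le (by positivity)
  have hk' : (n : ℝ) * t < k + 1 := Nat.lt_floor_add_one _
  have hTf : ‖T n f - f‖ ≤ (1 / n) * φ n f := by
    have h1 := hφ n hn f
    rw [norm_smul, Real.norm_of_nonneg hn0.le] at h1
    rw [one_div, le_inv_mul_iff₀ hn0]
    exact h1
  have hchernoff := norm_pow_apply_sub_exp_smul_sub_one_apply_le (hT n) k (f : U)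
  have hEE := norm_exp_smul_sub_one_apply_sub_le (hT n) (Nat.cast_nonneg k) hk (f : U)
  rw [mul_comm (n : ℝ) t, ← hEn] at hEE
  have hfirst : √(k : ℝ) * ‖T n f - f‖ ≤ √(t / n) * φ n f := by
    calc √(k : ℝ) * ‖T n f - f‖ ≤ √(n * t) * ((1 / n) * φ n f) := by gcongr
      _ = √(t / n) * φ n f := by
        have h1 : (n : ℝ) * t = n ^ 2 * (t / n) := by field_simp
        rw [h1, Real.sqrt_mul (by positivity), Real.sqrt_sq hn0.le]
        field_simp
  have hsecond : (t * n - k) * ‖T n f - f‖ ≤ (1 / n) * φ n f := by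
    have h1 : (t * n - k) * ‖T n f - f‖ ≤ 1 * ‖T n f - f‖ := by
      gcongr
      linarith
    linarith
  calc ‖(T n ^ k) (f : U) - S t f‖
      = ‖((T n ^ k) (f : U) - NormedSpace.exp ((k : ℝ) • (T n - 1)) (f : U)) -
          (E t f - NormedSpace.exp ((k : ℝ) • (T n - 1)) (f : U)) + (E t f - S t f)‖ := by
        congr 1; abel
    _ ≤ √(t / n) * φ n f + (1 / n) * φ n f + ∫ s in (0 : ℝ)..t, (ψ n (g s) : ℝ) := by
        refine (norm_add_le _ _).trans ?_
        gcongr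
        refine (norm_sub_le _ _).trans ?_
        gcongr
        exacts [hchernoff.trans hfirst, hEE.trans hsecond]
end
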